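/- Let G be an additively written cyclic group of order n ≥ 5 and let S be a zero-sum free sequence over G of length |S| = n - 2. Then there exists g ∈ G with ord(g) = n such that either S = (2g) · g^{[n-3]} or S = g^{[n-2]}. -/

import Mathlib

/-- A sequence is *zero-sum free* if no non-empty subsequence (multiset divisor)
has sum zero. -/
def IsZeroSumFree {G : Type*} [AddCommGroup G] (S : Multiset G) : Prop :=
  ∀ T : Multiset G, T ≤ S → T ≠ 0 → T.sum ≠ 0

open Classical in
/-- The set of all sums of (possibly empty) subsequences. -/
noncomputable def subSums {G : Type*} [AddCommGroup G] (T : Multiset G) : Finset G :=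
  (T.powerset.map Multiset.sum).toFinset

theorem mem_subSums {G : Type*} [AddCommGroup G] {T : Multiset G} {x : G} :
    x ∈ subSums T ↔ ∃ U, U ≤ T ∧ U.sum = x := by
  simp [subSums]

theorem IsZeroSumFree.mono {G : Type*} [AddCommGroup G] {S T : Multiset G}
    (h : IsZeroSumFree S) (hT : T ≤ S) : IsZeroSumFree T :=
  fun U hU => h U (hU.trans hT)

theorem card_subSums_cons {G : Type*} [AddCommGroup G] {T : Multiset G} {x : G}
    (h : IsZeroSumFree (x ::ₘ T)) : (subSums T).card + 1 ≤ (subSums (x ::ₘ T)).card := by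
  classical
  have hsub : subSums T ⊆ subSums (x ::ₘ T) := by
    intro y hy
    obtain ⟨U, hU, rfl⟩ := mem_subSums.1 hy
    exact mem_subSums.2 ⟨U, hU.trans (Multiset.le_cons_self _ _), rfl⟩
  apply Finset.card_lt_card
  refine hsub.ssubset_of_ne ?_
  intro heq
  have himg : (subSums T).image (fun y => x + y) ⊆ subSums T := by
    intro z hz
    obtain ⟨y, hy, rfl⟩ := Finset.mem_image.1 hz
    obtain ⟨U, hU, rfl⟩ := mem_subSums.1 hy
    rw [heq]
    exact mem_subSums.2 ⟨x ::ₘ U, (Multiset.cons_le_cons_iff x).2 hU, by simp⟩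
  have himg2 : (subSums T).image (fun y => x + y) = subSums T :=
    Finset.eq_of_subset_of_card_le himg
      (by rw [Finset.card_image_of_injective _ (add_right_injective x)])
  have h0 : (0 : G) ∈ subSums T := mem_subSums.2 ⟨0, Multiset.zero_le _, by simp⟩
  rw [← himg2] at h0
  obtain ⟨y, hy, hxy⟩ := Finset.mem_image.1 h0
  obtain ⟨U, hU, rfl⟩ := mem_subSums.1 hy
  exact h (x ::ₘ U) ((Multiset.cons_le_cons_iff x).2 hU) (by simp) (by simpa using hxy)

theorem card_subSums_add {G : Type*} [AddCommGroup G] (T R : Multiset G)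
    (h : IsZeroSumFree (R + T)) : (subSums T).card + R.card ≤ (subSums (R + T)).card := by
  induction R using Multiset.induction_on with
  | empty => simp
  | cons x R ih =>
    rw [Multiset.cons_add] at h ⊢
    have h1 := ih (h.mono (Multiset.le_cons_self _ _))
    have h2 := card_subSums_cons h
    rw [Multiset.card_cons]
    omega

theorem card_subSums_le {G : Type*} [AddCommGroup G] [Fintype G] {S T : Multiset G}
    (hS : IsZeroSumFree S) (hlen : Fintype.card G ≤ S.card + 2) (hT : T ≤ S) :
    (subSums T).card ≤ T.card + 2 := by
  obtain ⟨R, rfl⟩ := Multiset.le_iff_exists_add.1 hT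
  rw [add_comm] at hS hlen
  have h1 := card_subSums_add T R hS
  have h2 := Finset.card_le_univ (subSums (R + T))
  rw [Multiset.card_add] at hlen
  omega

theorem eq_add_of_three {G : Type*} [AddCommGroup G] {a b c : G}
    (hab : a ≠ b) (hac : a ≠ c) (hbc : b ≠ c)
    (hz : IsZeroSumFree ({a, b, c} : Multiset G))
    (hcard : (subSums ({a, b, c} : Multiset G)).card ≤ 5) : c = a + b := by
  classical
  by_contra hc
  have ha : a ≠ 0 := by simpa using hz {a} (by simp) (by simp)
  have hb : b ≠ 0 := by simpa using hz {b} (by simp) (by simp)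
  have hc0 : c ≠ 0 := by simpa using hz {c} (by simp) (by simp)
  have l1 : ({a, b} : Multiset G) ≤ {a, b, c} :=
    (Multiset.cons_le_cons_iff a).2 ((Multiset.cons_le_cons b (Multiset.zero_le _)))
  have l2 : ({b, c} : Multiset G) ≤ {a, b, c} := Multiset.le_cons_self _ _
  have l3 : ({a, c} : Multiset G) ≤ {a, b, c} :=
    (Multiset.cons_le_cons_iff a).2 (Multiset.le_cons_self _ _)
  have h1 : a + b ≠ 0 := by simpa using hz _ l1 (by simp)
  have h2 : b + c ≠ 0 := by simpa using hz _ l2 (by simp)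
  have h3 : a + c ≠ 0 := by simpa using hz _ l3 (by simp)
  have h4 : a + (b + c) ≠ 0 := by simpa using hz _ le_rfl (by simp)
  have hsub : ({0, a, b, a + b, c, a + (b + c)} : Finset G) ⊆ subSums {a, b, c} := by
    intro x hx
    simp only [Finset.mem_insert, Finset.mem_singleton] at hx
    rw [mem_subSums]
    rcases hx with rfl | rfl | rfl | rfl | rfl | rfl
    · exact ⟨0, by simp, by simp⟩
    · exact ⟨{x}, by simp, by simp⟩
    · exact ⟨{x}, by simp, by simp⟩
    · exact ⟨_, l1, by simp⟩
    · exact ⟨{x}, by simp, by simp⟩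
    · exact ⟨_, le_rfl, by simp⟩
  have h6 : ({0, a, b, a + b, c, a + (b + c)} : Finset G).card = 6 := by
    have e1 : b ≠ a + (b + c) := fun h => h3 (by
      have : b + 0 = b + (a + c) := by rw [add_zero]; exact h.trans (by abel)
      exact (add_left_cancel this).symm)
    have e2 : c ≠ a + (b + c) := fun h => h1 (by
      have : c + 0 = c + (a + b) := by rw [add_zero]; exact h.trans (by abel)
      exact (add_left_cancel this).symm)
    rw [Finset.card_insert_of_notMem, Finset.card_insert_of_notMem,
      Finset.card_insert_of_notMem, Finset.card_insert_of_notMem,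
      Finset.card_insert_of_notMem, Finset.card_singleton]
    all_goals
      simp only [Finset.mem_insert, Finset.mem_singleton, not_or]
    · exact e2
    · exact ⟨fun h => hc h.symm, by simpa using hc0⟩
    · exact ⟨by simpa using ha, hbc, e1⟩
    · exact ⟨hab, by simpa using hb, hac, by simpa using h2⟩
    · exact ⟨ha.symm, hb.symm, h1.symm, hc0.symm, h4.symm⟩
  have := Finset.card_le_card hsub
  omega

theorem eq_two_of_aab {G : Type*} [AddCommGroup G] {a b : G}
    (hab : a ≠ b)
    (hz : IsZeroSumFree ({a, a, b} : Multiset G))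
    (hcard : (subSums ({a, a, b} : Multiset G)).card ≤ 5) : b = 2 • a := by
  classical
  by_contra hc
  rw [two_nsmul] at hc
  have ha : a ≠ 0 := by simpa using hz {a} (by simp) (by simp)
  have hb : b ≠ 0 := by simpa using hz {b} (by simp) (by simp)
  have l1 : ({a, a} : Multiset G) ≤ {a, a, b} :=
    (Multiset.cons_le_cons_iff a).2 ((Multiset.cons_le_cons a (Multiset.zero_le _)))
  have l2 : ({a, b} : Multiset G) ≤ {a, a, b} := Multiset.le_cons_self _ _
  have h1 : a + a ≠ 0 := by simpa using hz _ l1 (by simp)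
  have h2 : a + b ≠ 0 := by simpa using hz _ l2 (by simp)
  have h4 : a + (a + b) ≠ 0 := by simpa using hz _ le_rfl (by simp)
  have hsub : ({0, a, b, a + b, a + a, a + (a + b)} : Finset G) ⊆ subSums {a, a, b} := by
    intro x hx
    simp only [Finset.mem_insert, Finset.mem_singleton] at hx
    rw [mem_subSums]
    rcases hx with rfl | rfl | rfl | rfl | rfl | rfl
    · exact ⟨0, by simp, by simp⟩
    · exact ⟨{x}, by simp, by simp⟩
    · exact ⟨{x}, by simp, by simp⟩
    · exact ⟨_, l2, by simp⟩
    · exact ⟨_, l1, by simp⟩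
    · exact ⟨_, le_rfl, by simp⟩
  have h6 : ({0, a, b, a + b, a + a, a + (a + b)} : Finset G).card = 6 := by
    have e1 : b ≠ a + (a + b) := fun h => h1 (by
      have : b + 0 = b + (a + a) := by rw [add_zero]; exact h.trans (by abel)
      exact (add_left_cancel this).symm)
    rw [Finset.card_insert_of_notMem, Finset.card_insert_of_notMem,
      Finset.card_insert_of_notMem, Finset.card_insert_of_notMem,
      Finset.card_insert_of_notMem, Finset.card_singleton]
    all_goals
      simp only [Finset.mem_insert, Finset.mem_singleton, not_or]
    · simpa using hb
    · exact ⟨by simpa using hab.symm, by simpa using ha⟩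
    · exact ⟨by simpa using ha, hc, e1⟩
    · exact ⟨hab, by simpa using hb, by simpa using ha, by simpa using h2⟩
    · exact ⟨ha.symm, hb.symm, h2.symm, h1.symm, h4.symm⟩
  have := Finset.card_le_card hsub
  omega

theorem zero_sum_free_of_length_sub_two
    (n : ℕ) (hn : 5 ≤ n)
    (G : Type*) [AddCommGroup G] [Fintype G] (hcyc : IsAddCyclic G)
    (hcard : Fintype.card G = n)
    (S : Multiset G) (hzsf : IsZeroSumFree S) (hlen : Multiset.card S = n - 2) :
    ∃ g : G, addOrderOf g = n ∧
      (S = (2 • g) ::ₘ Multiset.replicate (n - 3) g ∨ S = Multiset.replicate (n - 2) g) := by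
  classical
  have hle : ∀ T ≤ S, (subSums T).card ≤ T.card + 2 := fun T hT =>
    card_subSums_le hzsf (by omega) hT
  -- three distinct elements are impossible
  have h3 : ∀ a b c : G, a ≠ b → a ≠ c → b ≠ c → ({a, b, c} : Multiset G) ≤ S → False := by
    intro a b c hab hac hbc hT
    have p1 : ({a, b, c} : Multiset G) = {b, c, a} := by
      change a ::ₘ b ::ₘ c ::ₘ 0 = b ::ₘ c ::ₘ a ::ₘ 0
      rw [Multiset.cons_swap a b, Multiset.cons_swap a c]
    have p2 : ({a, b, c} : Multiset G) = {a, c, b} := by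
      change a ::ₘ b ::ₘ c ::ₘ 0 = a ::ₘ c ::ₘ b ::ₘ 0
      rw [Multiset.cons_swap b c]
    have c1 : c = a + b := eq_add_of_three hab hac hbc (hzsf.mono hT) (hle _ hT)
    have c2 : a = b + c := by
      have hT' := hT
      rw [p1] at hT'
      exact eq_add_of_three hbc hab.symm hac.symm (hzsf.mono hT') (hle _ hT')
    have c3 : b = a + c := by
      have hT' := hT
      rw [p2] at hT'
      exact eq_add_of_three hac hab hbc.symm (hzsf.mono hT') (hle _ hT')
    have h4 : a + (b + c) ≠ 0 := by simpa using hzsf _ hT (by simp)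
    apply h4
    have e1 : b + b = 0 := by
      have : a + (b + b) = a + 0 := by
        rw [add_zero]; nth_rw 2 [c2]; rw [c1]; abel
      exact add_left_cancel this
    have e2 : a + a = 0 := by
      have : b + (a + a) = b + 0 := by
        rw [add_zero]; nth_rw 2 [c3]; rw [c1]; abel
      exact add_left_cancel this
    calc a + (b + c) = (a + a) + (b + b) := by rw [c1]; abel
      _ = 0 := by rw [e1, e2, add_zero]
  have h2 : ∀ a b : G, a ≠ b → ({a, a, b} : Multiset G) ≤ S → b = 2 • a := by
    intro a b hab hT
    exact eq_two_of_aab hab (hzsf.mono hT) (hle _ hT)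
  -- there is a repeated element
  have hrep : ∃ a R, S = a ::ₘ a ::ₘ R := by
    obtain ⟨x, S1, rfl⟩ : ∃ x S1, S = x ::ₘ S1 := by
      obtain ⟨x, hx⟩ := Multiset.card_pos_iff_exists_mem.1 (show 0 < S.card by omega)
      exact ⟨x, Multiset.exists_cons_of_mem hx⟩
    rw [Multiset.card_cons] at hlen
    obtain ⟨y, S2, rfl⟩ : ∃ x S2, S1 = x ::ₘ S2 := by
      obtain ⟨x, hx⟩ := Multiset.card_pos_iff_exists_mem.1 (show 0 < S1.card by omega)
      exact ⟨x, Multiset.exists_cons_of_mem hx⟩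
    rw [Multiset.card_cons] at hlen
    obtain ⟨z, S3, rfl⟩ : ∃ x S3, S2 = x ::ₘ S3 := by
      obtain ⟨x, hx⟩ := Multiset.card_pos_iff_exists_mem.1 (show 0 < S2.card by omega)
      exact ⟨x, Multiset.exists_cons_of_mem hx⟩
    by_cases hxy : x = y
    · exact ⟨x, z ::ₘ S3, by rw [hxy]⟩
    by_cases hxz : x = z
    · exact ⟨x, y ::ₘ S3, by rw [← hxz, Multiset.cons_swap y x]⟩
    by_cases hyz : y = z
    · exact ⟨y, x ::ₘ S3, by rw [← hyz, Multiset.cons_swap x y, Multiset.cons_swap x y]⟩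
    exact (h3 x y z hxy hxz hyz (Multiset.cons_le_cons x (Multiset.cons_le_cons y
      (Multiset.cons_le_cons z (Multiset.zero_le _))))).elim
  obtain ⟨a, R, hS⟩ := hrep
  have hcS : R.card + 2 = n - 2 := by rw [← hlen, hS]; simp
  have hdvd : addOrderOf a ∣ n := hcard ▸ addOrderOf_dvd_card
  have hpos : 0 < addOrderOf a := addOrderOf_pos a
  have hord0 : addOrderOf a ≤ n := Nat.le_of_dvd (by omega) hdvd
  by_cases hall : ∀ b ∈ R, b = a
  · have hR : R = Multiset.replicate R.card a := Multiset.eq_replicate.2 ⟨rfl, hall⟩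
    have hS' : S = Multiset.replicate (n - 2) a := by
      rw [hS, ← hcS, Multiset.replicate_succ, Multiset.replicate_succ, ← hR]
    refine ⟨a, ?_, Or.inr hS'⟩
    have hgt : n - 2 < addOrderOf a := by
      by_contra hcon
      refine hzsf (Multiset.replicate (addOrderOf a) a) ?_ ?_ ?_
      · rw [hS']; exact Multiset.replicate_le_replicate a |>.2 (by omega)
      · intro h
        have := congrArg Multiset.card h
        rw [Multiset.card_replicate, Multiset.card_zero] at this
        omega
      · rw [Multiset.sum_replicate, addOrderOf_nsmul_eq_zero]
    obtain ⟨k, hk⟩ := hdvd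
    have : k < 2 := by
      by_contra hk2
      have : addOrderOf a * 2 ≤ addOrderOf a * k := Nat.mul_le_mul_left _ (by omega)
      omega
    interval_cases k <;> omega
  · push Not at hall
    obtain ⟨b, hbR, hba⟩ := hall
    obtain ⟨R', rfl⟩ := Multiset.exists_cons_of_mem hbR
    have hb : b = 2 • a := h2 a b hba.symm (by
      rw [hS]
      exact Multiset.cons_le_cons a (Multiset.cons_le_cons a
        (Multiset.cons_le_cons b (Multiset.zero_le _))))
    have hall' : ∀ c ∈ R', c = a := by
      intro c hc
      obtain ⟨R'', rfl⟩ := Multiset.exists_cons_of_mem hc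
      by_contra hca
      by_cases hcb : c = b
      · subst hcb
        have hS2 : S = a ::ₘ c ::ₘ c ::ₘ a ::ₘ R'' := by
          rw [hS, Multiset.cons_swap a c, Multiset.cons_swap a c R'']
        have hac : a = 2 • c := h2 c a hca (by
          rw [hS, Multiset.cons_swap a c, Multiset.cons_swap a c, Multiset.cons_swap a c,
            Multiset.cons_swap a c]
          exact Multiset.cons_le_cons c (Multiset.cons_le_cons c
            (Multiset.cons_le_cons a (Multiset.zero_le _))))
        have hne : a + c ≠ 0 := by
          have := hzsf {a, c} (by
            rw [hS2]
            exact Multiset.cons_le_cons a (Multiset.cons_le_cons c (Multiset.zero_le _))) (by simp)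
          simpa using this
        apply hne
        have : a + (a + c) = a + 0 := by
          rw [add_zero]
          nth_rw 3 [hac]
          rw [← add_assoc, ← two_nsmul, ← hb, two_nsmul]
        exact add_left_cancel this
      · refine h3 a b c hba.symm (fun h => hca h.symm) (fun h => hcb h.symm) ?_
        rw [hS]
        refine Multiset.cons_le_cons a (le_trans ?_ (Multiset.le_cons_self _ _))
        exact Multiset.cons_le_cons b (Multiset.cons_le_cons c (Multiset.zero_le _))
    have hR : R' = Multiset.replicate R'.card a := Multiset.eq_replicate.2 ⟨rfl, hall'⟩
    have hcR : R'.card + 2 = n - 3 := by rw [Multiset.card_cons] at hcS; omega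
    have hS' : S = (2 • a) ::ₘ Multiset.replicate (n - 3) a := by
      rw [hS, ← hcR, Multiset.replicate_succ, Multiset.replicate_succ, ← hR, ← hb,
        Multiset.cons_swap a b, Multiset.cons_swap a b]
    refine ⟨a, ?_, Or.inl hS'⟩
    by_contra hne
    by_cases h1 : addOrderOf a ≤ n - 3
    · refine hzsf (Multiset.replicate (addOrderOf a) a) ?_ ?_ ?_
      · rw [hS']
        exact ((Multiset.replicate_le_replicate a).2 h1).trans (Multiset.le_cons_self _ _)
      · intro h
        have := congrArg Multiset.card h
        rw [Multiset.card_replicate, Multiset.card_zero] at this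
        omega
      · rw [Multiset.sum_replicate, addOrderOf_nsmul_eq_zero]
    · refine hzsf ((2 • a) ::ₘ Multiset.replicate (addOrderOf a - 2) a) ?_ (by simp) ?_
      · rw [hS']
        exact Multiset.cons_le_cons _ ((Multiset.replicate_le_replicate a).2 (by omega))
      · rw [Multiset.sum_cons, Multiset.sum_replicate, ← add_nsmul,
          show 2 + (addOrderOf a - 2) = addOrderOf a by omega, addOrderOf_nsmul_eq_zero]
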